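/- Let u be a nonnegative continuous function on the box [a_1,a_2]×[b_1,b_2]. Then the map Υ ↦ J̃(u,Υ) is upper semi-continuous on B↗([a_1,a_2]×[b_1,b_2]) endowed with the Hausdorff metric. -/

import Mathlib

open MeasureTheory

/-- A monotone partition of the box `[a1,a2]×[b1,b2]` all of whose points lie on `Υ`. -/
def IsPartitionOn (a1 a2 b1 b2 : ℝ) (Υ : Set (ℝ × ℝ)) (n : ℕ) (x y : Fin (n + 1) → ℝ) : Prop :=
  Monotone x ∧ Monotone y ∧ x 0 = a1 ∧ y 0 = b1 ∧ x (Fin.last n) = a2 ∧ y (Fin.last n) = b2 ∧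
    ∀ k : Fin (n + 1), (x k, y k) ∈ Υ

/-- `J̃(u,P) = 2 Σ_k (∫_{x_k}^{x_{k+1}} ∫_{y_k}^{y_{k+1}} u(x,y) dx dy)^{1/2}`. -/
noncomputable def Jpart (u : ℝ × ℝ → ℝ) (n : ℕ) (x y : Fin (n + 1) → ℝ) : ℝ :=
  2 * ∑ k : Fin n,
    Real.sqrt (∫ s in (x k.castSucc)..(x k.succ), ∫ t in (y k.castSucc)..(y k.succ), u (s, t))

/-- `J̃(u,Υ) = lim_{ε→0} inf {J̃(u,P) : P a partition with points on Υ, mesh < ε}`; since the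
infimum is monotone as `ε` decreases, the limit equals the supremum over `ε > 0`. -/
noncomputable def Jcurve (a1 a2 b1 b2 : ℝ) (u : ℝ × ℝ → ℝ) (Υ : Set (ℝ × ℝ)) : ℝ :=
  ⨆ ε : {e : ℝ // 0 < e},
    sInf {r : ℝ | ∃ (n : ℕ) (x y : Fin (n + 1) → ℝ),
      IsPartitionOn a1 a2 b1 b2 Υ n x y ∧
      (∀ k : Fin n, x k.succ - x k.castSucc < (ε : ℝ) ∧ y k.succ - y k.castSucc < (ε : ℝ)) ∧
      r = Jpart u n x y}

/-- `B↗([a1,a2]×[b1,b2])`: connected subsets of the box, containing both corners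
`(a1,b1)` and `(a2,b2)`, on which `(x_1-x_2)(y_1-y_2) ≥ 0` for any two points. -/
def Bup (a1 a2 b1 b2 : ℝ) : Set (Set (ℝ × ℝ)) :=
  {Υ | Υ ⊆ Set.Icc (a1, b1) (a2, b2) ∧ IsConnected Υ ∧ (a1, b1) ∈ Υ ∧ (a2, b2) ∈ Υ ∧
    ∀ p ∈ Υ, ∀ q ∈ Υ, 0 ≤ (p.1 - q.1) * (p.2 - q.2)}

lemma sqrt_add_le_aux {a b : ℝ} (ha : 0 ≤ a) (hb : 0 ≤ b) :
    Real.sqrt (a + b) ≤ Real.sqrt a + Real.sqrt b := by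
  rw [Real.sqrt_le_left (by positivity)]
  nlinarith [Real.sq_sqrt ha, Real.sq_sqrt hb, Real.sqrt_nonneg a, Real.sqrt_nonneg b,
    mul_nonneg (Real.sqrt_nonneg a) (Real.sqrt_nonneg b)]

noncomputable def gI (v : ℝ × ℝ → ℝ) (p q : ℝ × ℝ) : ℝ :=
  ∫ s in p.1..q.1, ∫ t in p.2..q.2, v (s, t)

def PS (a1 a2 b1 b2 : ℝ) (v : ℝ × ℝ → ℝ) (Υ : Set (ℝ × ℝ)) (ε : ℝ) : Set ℝ :=
  {r | ∃ (n : ℕ) (p : ℕ → ℝ × ℝ), Monotone p ∧ p 0 = (a1, b1) ∧ p n = (a2, b2) ∧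
    (∀ k, p k ∈ Υ) ∧
    (∀ k < n, (p (k+1)).1 - (p k).1 < ε ∧ (p (k+1)).2 - (p k).2 < ε) ∧
    r = 2 * ∑ k ∈ Finset.range n, Real.sqrt (gI v (p k) (p (k+1)))}

lemma gI_congr {u v : ℝ × ℝ → ℝ} {p q : ℝ × ℝ} (hpq : p ≤ q)
    (h : ∀ z ∈ Set.Icc p q, u z = v z) : gI u p q = gI v p q := by
  unfold gI
  apply intervalIntegral.integral_congr
  intro s hs
  rw [Set.uIcc_of_le hpq.1] at hs
  apply intervalIntegral.integral_congr
  intro t ht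
  rw [Set.uIcc_of_le hpq.2] at ht
  exact h _ ⟨⟨hs.1, ht.1⟩, ⟨hs.2, ht.2⟩⟩

lemma PS_eq {a1 a2 b1 b2 : ℝ} {u v : ℝ × ℝ → ℝ} {Υ : Set (ℝ × ℝ)} (ε : ℝ)
    (hΥ : Υ ⊆ Set.Icc (a1, b1) (a2, b2))
    (huv : ∀ z ∈ Set.Icc (a1, b1) (a2, b2), u z = v z) :
    {r : ℝ | ∃ (n : ℕ) (x y : Fin (n + 1) → ℝ),
      IsPartitionOn a1 a2 b1 b2 Υ n x y ∧
      (∀ k : Fin n, x k.succ - x k.castSucc < (ε : ℝ) ∧ y k.succ - y k.castSucc < (ε : ℝ)) ∧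
      r = Jpart u n x y} = PS a1 a2 b1 b2 v Υ ε := by
  ext r
  constructor
  · rintro ⟨n, x, y, ⟨hx, hy, hx0, hy0, hxn, hyn, hm⟩, hmesh, rfl⟩
    have hlt : ∀ k, min k n < n + 1 := fun k => by omega
    have e1 : ∀ k : Fin n, (⟨min (k:ℕ) n, hlt _⟩ : Fin (n+1)) = k.castSucc := by
      intro k; ext; simp
    have e2 : ∀ k : Fin n, (⟨min ((k:ℕ)+1) n, hlt _⟩ : Fin (n+1)) = k.succ := by
      intro k; ext; simp
    have hmono : ∀ i j : ℕ, i ≤ j → (⟨min i n, hlt _⟩ : Fin (n+1)) ≤ ⟨min j n, hlt _⟩ := by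
      intro i j h; simp only [Fin.mk_le_mk]; omega
    refine ⟨n, fun k => (x ⟨min k n, hlt k⟩, y ⟨min k n, hlt k⟩), ?_, ?_, ?_, ?_, ?_, ?_⟩
    · intro i j h
      exact ⟨hx (hmono i j h), hy (hmono i j h)⟩
    · have : (⟨min 0 n, hlt 0⟩ : Fin (n+1)) = 0 := by ext; simp
      simp only [this, hx0, hy0]
    · have : (⟨min n n, hlt n⟩ : Fin (n+1)) = Fin.last n := by ext; simp
      simp only [this, hxn, hyn]
    · intro k; exact hm _
    · intro k hk
      have := hmesh ⟨k, hk⟩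
      rw [← e1, ← e2] at this
      exact this
    · unfold Jpart
      congr 1
      rw [← Fin.sum_univ_eq_sum_range (fun k => Real.sqrt (gI v (x ⟨min k n, hlt k⟩, y ⟨min k n, hlt k⟩)
        (x ⟨min (k+1) n, hlt _⟩, y ⟨min (k+1) n, hlt _⟩)))]
      apply Finset.sum_congr rfl
      intro k _
      rw [e1, e2, ← gI_congr (u := u)]
      · rfl
      · exact ⟨hx (Fin.castSucc_le_succ k), hy (Fin.castSucc_le_succ k)⟩
      · intro z hz
        exact huv z ⟨(hΥ (hm _)).1.trans hz.1, hz.2.trans (hΥ (hm _)).2⟩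
  · rintro ⟨n, p, hp, hp0, hpn, hm, hmesh, rfl⟩
    refine ⟨n, fun k => (p k).1, fun k => (p k).2, ⟨?_, ?_, ?_, ?_, ?_, ?_, ?_⟩, ?_, ?_⟩
    · intro i j h; exact (hp (show (i:ℕ) ≤ j from h)).1
    · intro i j h; exact (hp (show (i:ℕ) ≤ j from h)).2
    · simp [hp0]
    · simp [hp0]
    · simp [hpn]
    · simp [hpn]
    · intro k; exact hm k
    · intro k; simpa using hmesh k k.2
    · unfold Jpart
      congr 1
      rw [← Fin.sum_univ_eq_sum_range (fun k => Real.sqrt (gI v (p k) (p (k+1))))]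
      apply Finset.sum_congr rfl
      intro k _
      rw [← gI_congr (u := u)]
      · simp [gI]
      · exact hp (Nat.le_succ _)
      · intro z hz
        exact huv z ⟨(hΥ (hm _)).1.trans hz.1, hz.2.trans (hΥ (hm _)).2⟩

lemma inner_cont {v : ℝ × ℝ → ℝ} (hv : Continuous v) :
    Continuous (fun z : ℝ × ℝ × ℝ => ∫ t in z.2.1..z.2.2, v (z.1, t)) := by
  have h1 : ∀ f : ℝ × ℝ × ℝ → ℝ, Continuous f →
      Continuous (fun z : ℝ × ℝ × ℝ => ∫ t in (0:ℝ)..f z, v (z.1, t)) := by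
    intro f hf
    apply intervalIntegral.continuous_parametric_intervalIntegral_of_continuous (f := fun (z : ℝ × ℝ × ℝ) t => v (z.1, t)) _ hf
    unfold Function.uncurry
    fun_prop
  have h2 : (fun z : ℝ × ℝ × ℝ => ∫ t in z.2.1..z.2.2, v (z.1, t)) =
    fun z => (∫ t in (0:ℝ)..z.2.2, v (z.1, t)) - ∫ t in (0:ℝ)..z.2.1, v (z.1, t) := by
    ext z
    rw [intervalIntegral.integral_interval_sub_left] <;>
    exact Continuous.intervalIntegrable (by fun_prop) _ _
  rw [h2]
  exact (h1 _ (by fun_prop)).sub (h1 _ (by fun_prop))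

lemma gI_cont {v : ℝ × ℝ → ℝ} (hv : Continuous v) :
    Continuous (fun z : (ℝ × ℝ) × (ℝ × ℝ) => gI v z.1 z.2) := by
  have hi := inner_cont hv
  have h1 : ∀ f : (ℝ × ℝ) × (ℝ × ℝ) → ℝ, Continuous f →
      Continuous (fun z : (ℝ × ℝ) × (ℝ × ℝ) => ∫ s in (0:ℝ)..f z, ∫ t in z.1.2..z.2.2, v (s, t)) := by
    intro f hf
    apply intervalIntegral.continuous_parametric_intervalIntegral_of_continuous
      (f := fun (z : (ℝ × ℝ) × (ℝ × ℝ)) s => ∫ t in z.1.2..z.2.2, v (s, t)) _ hf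
    exact hi.comp (f := fun w : ((ℝ × ℝ) × (ℝ × ℝ)) × ℝ => (w.2, w.1.1.2, w.1.2.2)) (by fun_prop)
  have h2 : (fun z : (ℝ × ℝ) × (ℝ × ℝ) => gI v z.1 z.2) =
    fun z => (∫ s in (0:ℝ)..z.2.1, ∫ t in z.1.2..z.2.2, v (s, t)) -
      ∫ s in (0:ℝ)..z.1.1, ∫ t in z.1.2..z.2.2, v (s, t) := by
    ext z
    have hc : Continuous fun s => ∫ t in z.1.2..z.2.2, v (s, t) :=
      hi.comp (f := fun s : ℝ => (s, z.1.2, z.2.2)) (by fun_prop)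
    rw [intervalIntegral.integral_interval_sub_left]
    · rfl
    all_goals exact hc.intervalIntegrable _ _
  rw [h2]
  exact (h1 _ (by fun_prop)).sub (h1 _ (by fun_prop))

lemma gI_const (C : ℝ) (p q : ℝ × ℝ) : gI (fun _ => C) p q = C * ((q.1 - p.1) * (q.2 - p.2)) := by
  simp [gI]; ring

lemma gI_mono {v w : ℝ × ℝ → ℝ} (hv : Continuous v) (hw : Continuous w) {p q : ℝ × ℝ} (hpq : p ≤ q)
    (h : ∀ z ∈ Set.Icc p q, v z ≤ w z) : gI v p q ≤ gI w p q := by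
  have hc : ∀ v : ℝ × ℝ → ℝ, Continuous v → Continuous fun s => ∫ t in p.2..q.2, v (s, t) :=
    fun v hv => (inner_cont hv).comp (f := fun s : ℝ => (s, p.2, q.2)) (by fun_prop)
  apply intervalIntegral.integral_mono_on hpq.1 ((hc v hv).intervalIntegrable _ _)
    ((hc w hw).intervalIntegrable _ _)
  intro s hs
  apply intervalIntegral.integral_mono_on hpq.2
    (Continuous.intervalIntegrable (by fun_prop) _ _) (Continuous.intervalIntegrable (by fun_prop) _ _)
  intro t ht
  exact h _ ⟨⟨hs.1, ht.1⟩, ⟨hs.2, ht.2⟩⟩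

lemma cell {v : ℝ × ℝ → ℝ} (hv : Continuous v) (hv0 : ∀ z, 0 ≤ v z) {ω : ℝ} (hω : 0 ≤ ω) (N : ℕ)
    (p : ℕ → ℝ × ℝ) (hp : Monotone p)
    (hosc : ∀ z ∈ Set.Icc (p 0) (p N), ∀ w ∈ Set.Icc (p 0) (p N), v z ≤ v w + ω) :
    ∑ j ∈ Finset.range N, Real.sqrt (gI v (p j) (p (j+1))) ≤
      Real.sqrt (gI v (p 0) (p N)) +
      Real.sqrt ω * (Real.sqrt ((p N).1 - (p 0).1) * Real.sqrt ((p N).2 - (p 0).2)) := by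
  have h0N : p 0 ≤ p N := hp (Nat.zero_le _)
  obtain ⟨q, hq, hmin⟩ := (isCompact_Icc (a := p 0) (b := p N)).exists_isMinOn
    ⟨p 0, le_rfl, h0N⟩ hv.continuousOn
  have hA : 0 ≤ (p N).1 - (p 0).1 := sub_nonneg.2 h0N.1
  have hB : 0 ≤ (p N).2 - (p 0).2 := sub_nonneg.2 h0N.2
  have hlow : v q * (((p N).1 - (p 0).1) * ((p N).2 - (p 0).2)) ≤ gI v (p 0) (p N) := by
    rw [← gI_const]
    exact gI_mono continuous_const hv h0N (fun z hz => hmin hz)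
  have hup : ∀ j ∈ Finset.range N, Real.sqrt (gI v (p j) (p (j+1))) ≤ Real.sqrt (v q + ω) *
      (Real.sqrt ((p (j+1)).1 - (p j).1) * Real.sqrt ((p (j+1)).2 - (p j).2)) := by
    intro j hj
    have hj := Finset.mem_range.1 hj
    have hjj : p j ≤ p (j+1) := hp (Nat.le_succ _)
    rw [← Real.sqrt_mul (sub_nonneg.2 hjj.1), ← Real.sqrt_mul (add_nonneg (hv0 q) hω)]
    apply Real.sqrt_le_sqrt
    rw [← gI_const]
    refine gI_mono hv continuous_const hjj (fun z hz => hosc z ⟨?_, ?_⟩ q hq)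
    · exact (hp (Nat.zero_le _)).trans hz.1
    · exact hz.2.trans (hp (by omega))
  refine (Finset.sum_le_sum hup).trans ?_
  rw [← Finset.mul_sum]
  have hcs := Real.sum_sqrt_mul_sqrt_le (Finset.range N)
    (f := fun j => (p (j+1)).1 - (p j).1) (g := fun j => (p (j+1)).2 - (p j).2)
    (fun j => sub_nonneg.2 (hp (Nat.le_succ _)).1) (fun j => sub_nonneg.2 (hp (Nat.le_succ _)).2)
  rw [Finset.sum_range_sub (fun j => (p j).1), Finset.sum_range_sub (fun j => (p j).2)] at hcs
  refine (mul_le_mul_of_nonneg_left hcs (Real.sqrt_nonneg _)).trans ?_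
  have h1 : Real.sqrt (v q + ω) ≤ Real.sqrt (v q) + Real.sqrt ω := sqrt_add_le_aux (hv0 q) hω
  have h2 : Real.sqrt (v q) * (Real.sqrt ((p N).1 - (p 0).1) * Real.sqrt ((p N).2 - (p 0).2)) ≤
     Real.sqrt (gI v (p 0) (p N)) := by
    rw [← Real.sqrt_mul hA, ← Real.sqrt_mul (hv0 q)]
    exact Real.sqrt_le_sqrt hlow
  have h3 := mul_le_mul_of_nonneg_right h1 (mul_nonneg (Real.sqrt_nonneg ((p N).1 - (p 0).1)) (Real.sqrt_nonneg ((p N).2 - (p 0).2)))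
  rw [add_mul] at h3
  linarith

lemma chain_le {p q : ℝ × ℝ} (h : 0 ≤ (p.1 - q.1) * (p.2 - q.2)) (hs : p.1 + p.2 ≤ q.1 + q.2) :
    p ≤ q := by
  constructor
  · by_contra hc
    push Not at hc
    nlinarith
  · by_contra hc
    push Not at hc
    nlinarith

lemma param {a1 a2 b1 b2 : ℝ} {Υ : Set (ℝ × ℝ)} (h : Υ ∈ Bup a1 a2 b1 b2) :
    ∃ γ : ℝ → ℝ × ℝ, ∀ s ∈ Set.Icc (a1 + b1) (a2 + b2), γ s ∈ Υ ∧ (γ s).1 + (γ s).2 = s := by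
  obtain ⟨hbox, hconn, h1, h2, hch⟩ := h
  have : ∀ s ∈ Set.Icc (a1 + b1) (a2 + b2), ∃ q ∈ Υ, q.1 + q.2 = s := by
    have := hconn.isPreconnected.intermediate_value h1 h2 (f := fun q : ℝ × ℝ => q.1 + q.2)
      (by fun_prop)
    exact this
  choose! γ hγ using this
  exact ⟨γ, hγ⟩

/-- Piecewise linear interpolation. -/
lemma interp (n : ℕ) (s : ℕ → ℝ) (hs : Monotone s) :
    ∃ S : ℝ → ℝ, Monotone S ∧ (∀ k ≤ n, S (k:ℝ) = s k) ∧
      (∀ t t', t ≤ t' → S t' - S t ≤ (s n - s 0) * (t' - t)) := by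
  have cl : ∀ x y : ℝ, x ≤ y → max 0 (min 1 y) - max 0 (min 1 x) ≤ y - x := by
    intro x y h
    rcases max_cases 0 (min 1 y) with h1 | h1 <;> rcases max_cases 0 (min 1 x) with h2 | h2 <;>
    rcases min_cases 1 y with h3 | h3 <;> rcases min_cases 1 x with h4 | h4 <;> linarith
  have hd : ∀ j, 0 ≤ s (j+1) - s j := fun j => sub_nonneg.2 (hs (Nat.le_succ _))
  refine ⟨fun t => s 0 + ∑ j ∈ Finset.range n, (s (j+1) - s j) * max 0 (min 1 (t - j)), ?_, ?_, ?_⟩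
  · intro t t' h
    dsimp only
    gcongr with j _
    exact hd j
  · intro k hk
    obtain ⟨m, rfl⟩ := Nat.exists_eq_add_of_le hk
    dsimp only
    rw [Finset.sum_range_add]
    have e1 : ∑ x ∈ Finset.range k, (s (x+1) - s x) * max 0 (min 1 ((k:ℝ) - x)) =
       ∑ x ∈ Finset.range k, (s (x+1) - s x) := by
      apply Finset.sum_congr rfl
      intro x hx
      have : (x:ℝ) + 1 ≤ k := by exact_mod_cast Finset.mem_range.1 hx
      rw [min_eq_left (by linarith)]; simp
    have e2 : ∑ x ∈ Finset.range m, (s (k + x+1) - s (k+x)) * max 0 (min 1 ((k:ℝ) - ((k + x : ℕ):ℝ))) = 0 := by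
      apply Finset.sum_eq_zero
      intro x hx
      have : (0:ℝ) ≤ x := Nat.cast_nonneg x
      push_cast
      rw [max_eq_left]; · simp
      exact (min_le_right _ _).trans (by linarith)
    rw [e1, e2, Finset.sum_range_sub]
    ring
  · intro t t' h
    dsimp only
    rw [add_sub_add_left_eq_sub, ← Finset.sum_sub_distrib, ← Finset.sum_range_sub s, Finset.sum_mul]
    apply Finset.sum_le_sum
    intro j _
    rw [← mul_sub]
    apply mul_le_mul_of_nonneg_left _ (hd j)
    refine (cl _ _ (by linarith)).trans (by linarith)

lemma sum_blocks (f : ℕ → ℝ) (n N : ℕ) : ∑ i ∈ Finset.range (n * N), f i =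
    ∑ k ∈ Finset.range n, ∑ j ∈ Finset.range N, f (k * N + j) := by
  induction n with
  | zero => simp
  | succ n ih => rw [Nat.succ_mul, Finset.sum_range_add, ih, Finset.sum_range_succ]

lemma PS_nonneg {a1 a2 b1 b2 : ℝ} {v : ℝ × ℝ → ℝ} {Υ : Set (ℝ × ℝ)} {ε : ℝ} :
    ∀ r ∈ PS a1 a2 b1 b2 v Υ ε, 0 ≤ r := by
  rintro r ⟨n, p, -, -, -, -, -, rfl⟩
  positivity

lemma refine_le {a1 a2 b1 b2 : ℝ} {v : ℝ × ℝ → ℝ} {Υ : Set (ℝ × ℝ)}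
    (hΥ : Υ ∈ Bup a1 a2 b1 b2) (hv : Continuous v) (hv0 : ∀ z, 0 ≤ v z) {ω : ℝ} (hω : 0 ≤ ω)
    (n : ℕ) (p : ℕ → ℝ × ℝ) (hp : Monotone p) (hp0 : p 0 = (a1, b1)) (hpn : p n = (a2, b2))
    (hm : ∀ k, p k ∈ Υ)
    (hosc : ∀ k < n, ∀ z ∈ Set.Icc (p k) (p (k+1)), ∀ w ∈ Set.Icc (p k) (p (k+1)), v z ≤ v w + ω)
    {ε : ℝ} (hε : 0 < ε) :
    ∃ r ∈ PS a1 a2 b1 b2 v Υ ε, r ≤ 2 * ∑ k ∈ Finset.range n, Real.sqrt (gI v (p k) (p (k+1))) +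
      2 * (Real.sqrt ω * (Real.sqrt (a2 - a1) * Real.sqrt (b2 - b1))) := by
  obtain ⟨γ, hγ⟩ := param hΥ
  obtain ⟨hbox, hconn, hc1, hc2, hch⟩ := hΥ
  obtain ⟨S, hSm, hSk, hSL⟩ := interp n (fun k => (p k).1 + (p k).2)
    (fun i j h => add_le_add (hp h).1 (hp h).2)
  have hS0 : S 0 = a1 + b1 := by simpa [hp0] using hSk 0 (Nat.zero_le _)
  have hSn : S n = a2 + b2 := by simpa [hpn] using hSk n le_rfl
  obtain ⟨N, hN⟩ := exists_nat_gt ((a2 + b2 - (a1 + b1)) / ε)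
  have hab : a1 + b1 ≤ a2 + b2 := add_le_add (hbox hc1).2.1 (hbox hc1).2.2
  have hNpos : (0:ℝ) < N := lt_of_le_of_lt (div_nonneg (by linarith) hε.le) hN
  rw [div_lt_iff₀ hε] at hN
  set τ : ℕ → ℝ := fun i => min (n:ℝ) ((i:ℝ) / N) with hτ
  have hτm : Monotone τ := by
    intro i j h
    apply min_le_min_left
    gcongr
  have hτk : ∀ k ≤ n, τ (k * N) = k := by
    intro k hk
    have : (k:ℝ) ≤ n := by exact_mod_cast hk
    simp only [hτ]; push_cast
    rw [mul_div_cancel_right₀ _ hNpos.ne', min_eq_right this]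
  have hτI : ∀ i, S (τ i) ∈ Set.Icc (a1 + b1) (a2 + b2) := by
    intro i
    rw [← hS0, ← hSn]
    exact ⟨hSm (le_min (by positivity) (by positivity)), hSm (min_le_left _ _)⟩
  set P : ℕ → ℝ × ℝ := fun i => γ (S (τ i)) with hP
  have hPm : ∀ i, P i ∈ Υ := fun i => (hγ _ (hτI i)).1
  have hPs : ∀ i, (P i).1 + (P i).2 = S (τ i) := fun i => (hγ _ (hτI i)).2
  have hPmono : Monotone P := by
    intro i j h
    apply chain_le (hch _ (hPm i) _ (hPm j))
    rw [hPs, hPs]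
    exact hSm (hτm h)
  have hPk : ∀ k ≤ n, P (k * N) = p k := by
    intro k hk
    have e : (P (k*N)).1 + (P (k*N)).2 = (p k).1 + (p k).2 := by rw [hPs, hτk k hk, hSk k hk]
    exact le_antisymm (chain_le (hch _ (hPm _) _ (hm k)) e.le) (chain_le (hch _ (hm k) _ (hPm _)) e.ge)
  refine ⟨_, ⟨n * N, P, hPmono, ?_, ?_, hPm, ?_, rfl⟩, ?_⟩
  · simpa [hp0] using hPk 0 (Nat.zero_le _)
  · rw [hPk n le_rfl, hpn]
  · intro i _
    have h1 := hSL (τ i) (τ (i+1)) (hτm (Nat.le_succ _))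
    rw [hp0, hpn] at h1
    have h2 : τ (i+1) - τ i ≤ 1 / N := by
      have e : ((i+1 : ℕ):ℝ) / N = (i:ℝ)/N + 1/N := by push_cast; ring
      have : (0:ℝ) < 1 / N := by positivity
      simp only [hτ]
      rw [e]
      rcases min_cases (n:ℝ) ((i:ℝ)/N) with h | h <;>
      rcases min_cases (n:ℝ) ((i:ℝ)/N + 1/N) with h' | h' <;> linarith
    have h3 : (a2 + b2 - (a1 + b1)) * (τ (i+1) - τ i) < ε := by
      refine (mul_le_mul_of_nonneg_left h2 (by linarith)).trans_lt ?_
      rw [mul_one_div, div_lt_iff₀ hNpos]; linarith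
    have h4 := hPmono (Nat.le_succ i)
    have h5 := hPs i
    have h6 := hPs (i+1)
    have h7 := h4.1
    have h8 := h4.2
    simp only [Nat.succ_eq_add_one] at h7 h8
    dsimp only at h1
    constructor <;> linarith
  · rw [sum_blocks, ← mul_add]
    apply mul_le_mul_of_nonneg_left _ (by norm_num)
    have hcs := Real.sum_sqrt_mul_sqrt_le (Finset.range n)
      (f := fun j => (p (j+1)).1 - (p j).1) (g := fun j => (p (j+1)).2 - (p j).2)
      (fun j => sub_nonneg.2 (hp (Nat.le_succ _)).1) (fun j => sub_nonneg.2 (hp (Nat.le_succ _)).2)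
    rw [Finset.sum_range_sub (fun j => (p j).1), Finset.sum_range_sub (fun j => (p j).2), hp0, hpn] at hcs
    refine le_trans ?_ (add_le_add_right (mul_le_mul_of_nonneg_left hcs (Real.sqrt_nonneg ω)) _)
    rw [Finset.mul_sum, ← Finset.sum_add_distrib]
    apply Finset.sum_le_sum
    intro k hk
    have hk := Finset.mem_range.1 hk
    have e1 : P (k * N + 0) = p k := hPk k hk.le
    have e2 : P (k * N + N) = p (k+1) := by rw [← hPk (k+1) hk, Nat.succ_mul]
    have := cell hv hv0 hω N (fun j => P (k * N + j)) (fun i j h => hPmono (by omega))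
      (by simp only [e1, e2]; exact hosc k hk)
    simp only [e1, e2] at this
    exact this

lemma sum_cont {v : ℝ × ℝ → ℝ} (hv : Continuous v) (p : ℕ → ℝ × ℝ) (n : ℕ) :
    ∀ η > 0, ∃ δ > 0, ∀ p' : ℕ → ℝ × ℝ, (∀ k ≤ n, dist (p' k) (p k) < δ) →
      ∑ k ∈ Finset.range n, Real.sqrt (gI v (p' k) (p' (k+1))) <
      ∑ k ∈ Finset.range n, Real.sqrt (gI v (p k) (p (k+1))) + η := by
  induction n with
  | zero => intro η hη; exact ⟨1, one_pos, fun p' _ => by simpa using hη⟩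
  | succ n ih =>
    intro η hη
    obtain ⟨δ, hδ, h⟩ := ih (η/2) (by positivity)
    have hc : Continuous (fun z : (ℝ × ℝ) × (ℝ × ℝ) => Real.sqrt (gI v z.1 z.2)) :=
      (gI_cont hv).sqrt
    obtain ⟨δ', hδ', h'⟩ := Metric.continuous_iff.1 hc (p n, p (n+1)) (η/2) (by positivity)
    refine ⟨min δ δ', lt_min hδ hδ', fun p' hp' => ?_⟩
    have h1 := h p' (fun k hk => (hp' k (by omega)).trans_le (min_le_left _ _))
    have h2 := h' (p' n, p' (n+1)) (by
      rw [Prod.dist_eq]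
      exact max_lt ((hp' n (by omega)).trans_le (min_le_right _ _)) ((hp' (n+1) le_rfl).trans_le (min_le_right _ _)))
    rw [Real.dist_eq] at h2
    have h3 := (abs_lt.1 h2).2
    rw [Finset.sum_range_succ, Finset.sum_range_succ]
    dsimp only at h3
    linarith

lemma dist_of_chain {p q : ℝ × ℝ} (h : 0 ≤ (p.1 - q.1) * (p.2 - q.2)) :
    dist p q ≤ |(p.1 + p.2) - (q.1 + q.2)| := by
  rw [Prod.dist_eq, Real.dist_eq, Real.dist_eq]
  have h' : 0 ≤ (q.1 - p.1) * (q.2 - p.2) := by linarith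
  rcases le_total (p.1 + p.2) (q.1 + q.2) with hs | hs
  · have := chain_le h hs
    have h1 := this.1
    have h2 := this.2
    rw [abs_of_nonpos (by linarith), abs_of_nonpos (by linarith), abs_of_nonpos (by linarith)]
    apply max_le <;> linarith
  · have := chain_le h' hs
    have h1 := this.1
    have h2 := this.2
    rw [abs_of_nonneg (by linarith), abs_of_nonneg (by linarith), abs_of_nonneg (by linarith)]
    apply max_le <;> linarith

/-- Upper semicontinuity of `Υ ↦ J̃(u,Υ)` on `B↗`, relative to the Hausdorff metric. -/
theorem Jcurve_upperSemicontinuous (a1 a2 b1 b2 : ℝ) (ha : a1 ≤ a2) (hb : b1 ≤ b2)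
    (u : ℝ × ℝ → ℝ) (hu : ContinuousOn u (Set.Icc (a1, b1) (a2, b2)))
    (hu0 : ∀ p ∈ Set.Icc (a1, b1) (a2, b2), 0 ≤ u p) :
    ∀ Υ ∈ Bup a1 a2 b1 b2, ∀ c : ℝ, Jcurve a1 a2 b1 b2 u Υ < c →
      ∃ δ > 0, ∀ Υ' ∈ Bup a1 a2 b1 b2,
        Metric.hausdorffDist Υ Υ' < δ → Jcurve a1 a2 b1 b2 u Υ' < c := by
  intro Υ hΥ c hc
  -- extension of `u` to a continuous nonnegative function on the plane
  let v : ℝ × ℝ → ℝ := fun z => u (max a1 (min a2 z.1), max b1 (min b2 z.2))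
  have hbx : ∀ z : ℝ × ℝ, (max a1 (min a2 z.1), max b1 (min b2 z.2)) ∈ Set.Icc (a1, b1) (a2, b2) := by
    intro z
    exact ⟨⟨le_max_left _ _, le_max_left _ _⟩,
      ⟨max_le ha (min_le_left _ _), max_le hb (min_le_left _ _)⟩⟩
  have hv : Continuous v := hu.comp_continuous (by fun_prop) hbx
  have hv0 : ∀ z, 0 ≤ v z := fun z => hu0 _ (hbx z)
  have huv : ∀ z ∈ Set.Icc (a1, b1) (a2, b2), u z = v z := by
    rintro ⟨z1, z2⟩ ⟨⟨h1, h2⟩, ⟨h3, h4⟩⟩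
    simp only at h1 h2 h3 h4
    simp only [v]
    rw [min_eq_right h3, min_eq_right h4, max_eq_right h1, max_eq_right h2]
  have hJ : ∀ Υ ∈ Bup a1 a2 b1 b2, Jcurve a1 a2 b1 b2 u Υ =
      ⨆ ε : {e : ℝ // 0 < e}, sInf (PS a1 a2 b1 b2 v Υ ε) := by
    intro Υ hΥ
    unfold Jcurve
    congr 1
    ext ε
    rw [PS_eq (v := v) (ε : ℝ) hΥ.1 huv]
  have hbdd : ∀ (Υ : Set (ℝ × ℝ)) (ε : ℝ), BddBelow (PS a1 a2 b1 b2 v Υ ε) :=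
    fun Υ ε => ⟨0, fun r hr => PS_nonneg r hr⟩
  -- a crude bound
  obtain ⟨M, hM0, hM⟩ : ∃ M : ℝ, 0 ≤ M ∧ ∀ z, v z ≤ M := by
    obtain ⟨M, hM⟩ := (isCompact_Icc (a := (a1, b1)) (b := (a2, b2))).bddAbove_image hu
    have : ∀ z, v z ≤ M := fun z => hM ⟨_, hbx z, rfl⟩
    exact ⟨M, (hv0 0).trans (this 0), this⟩
  have hcrude : ∃ K : ℝ, ∀ ε : {e : ℝ // 0 < e}, ∃ r ∈ PS a1 a2 b1 b2 v Υ ε, r ≤ K := by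
    refine ⟨_, fun ε => refine_le hΥ hv hv0 hM0 1
      (fun k => if k = 0 then (a1, b1) else (a2, b2)) ?_ (by simp) (by simp) ?_ ?_ ε.2⟩
    · apply monotone_nat_of_le_succ
      intro k
      by_cases hk : k = 0
      · simp [hk, ha, hb]
      · simp [hk]
    · intro k
      by_cases hk : k = 0
      · simpa [hk] using hΥ.2.2.1
      · simpa [hk] using hΥ.2.2.2.1
    · intro k _ z _ w _
      have := hM z
      have := hv0 w
      linarith
  obtain ⟨K, hK⟩ := hcrude
  have hBA : BddAbove (Set.range fun ε : {e : ℝ // 0 < e} => sInf (PS a1 a2 b1 b2 v Υ ε)) := by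
    refine ⟨K, ?_⟩
    rintro _ ⟨ε, rfl⟩
    obtain ⟨r, hr, hrK⟩ := hK ε
    exact (csInf_le (hbdd _ _) hr).trans hrK
  rw [hJ Υ hΥ] at hc
  obtain ⟨c', hc1, hc2⟩ := exists_between hc
  -- choose the oscillation
  set L : ℝ := Real.sqrt (a2 - a1) * Real.sqrt (b2 - b1) with hL
  have hL0 : 0 ≤ L := by positivity
  set η : ℝ := (c - c') / 4 with hη
  have hηpos : 0 < η := by simp only [hη]; linarith
  set ω : ℝ := (η / (2 * (L + 1))) ^ 2 with hω
  have hωpos : 0 < ω := by positivity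
  have hωL : 2 * (Real.sqrt ω * L) ≤ η := by
    rw [hω, Real.sqrt_sq (by positivity)]
    have : 2 * (η / (2 * (L + 1)) * L) = η * (L / (L + 1)) := by field_simp
    rw [this]
    have : L / (L + 1) ≤ 1 := by rw [div_le_one (by linarith)]; linarith
    nlinarith
  obtain ⟨e, he, hUC⟩ := Metric.uniformContinuousOn_iff.1
    ((isCompact_Icc (a := (a1, b1)) (b := (a2, b2))).uniformContinuousOn_of_continuous
      hv.continuousOn) ω hωpos
  have h1 : sInf (PS a1 a2 b1 b2 v Υ (e/2)) < c' :=
    (le_ciSup hBA ⟨e/2, by positivity⟩).trans_lt hc1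
  obtain ⟨r, hr, hrc⟩ := exists_lt_of_csInf_lt
    (let ⟨r, hr, _⟩ := hK ⟨e/2, by positivity⟩; ⟨r, hr⟩) h1
  obtain ⟨n, p, hp, hp0, hpn, hm, hmesh, rfl⟩ := hr
  obtain ⟨δ, hδ, hcont⟩ := sum_cont hv p n (η/2) (by positivity)
  refine ⟨min δ (e/4) / 3, by positivity, fun Υ' hΥ' hdist => ?_⟩
  set d := min δ (e/4) / 3 with hd
  obtain ⟨γ, hγ⟩ := param hΥ'
  have hsI : ∀ k, (p k).1 + (p k).2 ∈ Set.Icc (a1 + b1) (a2 + b2) := fun k =>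
    ⟨add_le_add (hΥ.1 (hm k)).1.1 (hΥ.1 (hm k)).1.2, add_le_add (hΥ.1 (hm k)).2.1 (hΥ.1 (hm k)).2.2⟩
  let p' : ℕ → ℝ × ℝ := fun k => γ ((p k).1 + (p k).2)
  have hp'm : ∀ k, p' k ∈ Υ' := fun k => (hγ _ (hsI k)).1
  have hp's : ∀ k, (p' k).1 + (p' k).2 = (p k).1 + (p k).2 := fun k => (hγ _ (hsI k)).2
  have hch := hΥ'.2.2.2.2
  have hp'mono : Monotone p' := by
    intro i j h
    apply chain_le (hch _ (hp'm i) _ (hp'm j))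
    rw [hp's, hp's]
    exact add_le_add (hp h).1 (hp h).2
  have hend : ∀ k, p k ∈ Υ' → p' k = p k := by
    intro k hk
    have e := hp's k
    exact le_antisymm (chain_le (hch _ (hp'm _) _ hk) e.le) (chain_le (hch _ hk _ (hp'm _)) e.ge)
  have hp'0 : p' 0 = (a1, b1) := by
    rw [hend 0 (by rw [hp0]; exact hΥ'.2.2.1), hp0]
  have hp'n : p' n = (a2, b2) := by
    rw [hend n (by rw [hpn]; exact hΥ'.2.2.2.1), hpn]
  have hbd : ∀ Υ ∈ Bup a1 a2 b1 b2, Bornology.IsBounded Υ := fun Υ h =>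
    (isCompact_Icc (a := (a1, b1)) (b := (a2, b2))).isBounded.subset h.1
  have hfin : Metric.hausdorffEDist Υ Υ' ≠ ⊤ :=
    Metric.hausdorffEDist_ne_top_of_nonempty_of_bounded ⟨_, hΥ.2.2.1⟩ ⟨_, hΥ'.2.2.1⟩
      (hbd _ hΥ) (hbd _ hΥ')
  have hclose : ∀ k, dist (p' k) (p k) < 3 * d := by
    intro k
    obtain ⟨q, hq, hqd⟩ := Metric.exists_dist_lt_of_hausdorffDist_lt (hm k) hdist hfin
    have h1 := dist_of_chain (hch _ (hp'm k) _ hq)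
    rw [hp's] at h1
    have h2 := hqd
    rw [Prod.dist_eq, Real.dist_eq, Real.dist_eq, max_lt_iff] at h2
    have h3 : |((p k).1 + (p k).2) - (q.1 + q.2)| ≤ |(p k).1 - q.1| + |(p k).2 - q.2| := by
      have : ((p k).1 + (p k).2) - (q.1 + q.2) = ((p k).1 - q.1) + ((p k).2 - q.2) := by ring
      rw [this]; exact abs_add_le _ _
    have h4 := dist_triangle (p' k) q (p k)
    rw [dist_comm q] at h4
    linarith [h2.1, h2.2]
  have h3d : 3 * d = min δ (e/4) := by simp only [hd]; ring
  have hcδ : ∀ k ≤ n, dist (p' k) (p k) < δ := fun k _ =>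
    (hclose k).trans_le (h3d ▸ min_le_left _ _)
  have hce : ∀ k, |(p' k).1 - (p k).1| < e / 4 ∧ |(p' k).2 - (p k).2| < e / 4 := by
    intro k
    have := (hclose k).trans_le (h3d.le.trans (min_le_right _ _))
    rwa [Prod.dist_eq, Real.dist_eq, Real.dist_eq, max_lt_iff] at this
  have hsum := hcont p' hcδ
  have hosc : ∀ k < n, ∀ z ∈ Set.Icc (p' k) (p' (k+1)), ∀ w ∈ Set.Icc (p' k) (p' (k+1)),
      v z ≤ v w + ω := by
    intro k hk z hz w hw
    have hin : ∀ z ∈ Set.Icc (p' k) (p' (k+1)), z ∈ Set.Icc (a1, b1) (a2, b2) := fun z hz =>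
      ⟨(hΥ'.1 (hp'm _)).1.trans hz.1, hz.2.trans (hΥ'.1 (hp'm _)).2⟩
    have hzw : dist z w < e := by
      have m := hmesh k hk
      have c1 := hce k
      have c2 := hce (k+1)
      simp only [abs_lt] at c1 c2
      have z1 := hz.1.1
      have z2 := hz.1.2
      have z3 := hz.2.1
      have z4 := hz.2.2
      have w1 := hw.1.1
      have w2 := hw.1.2
      have w3 := hw.2.1
      have w4 := hw.2.2
      rw [Prod.dist_eq, Real.dist_eq, Real.dist_eq, max_lt_iff, abs_lt, abs_lt]
      refine ⟨⟨?_, ?_⟩, ⟨?_, ?_⟩⟩ <;> linarith [m.1, m.2, c1.1.1, c1.1.2, c1.2.1, c1.2.2, c2.1.1, c2.1.2, c2.2.1, c2.2.2]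
    have := hUC z (hin z hz) w (hin w hw) hzw
    rw [Real.dist_eq, abs_lt] at this
    linarith [this.2]
  rw [hJ Υ' hΥ']
  haveI : Nonempty {e : ℝ // 0 < e} := ⟨⟨1, one_pos⟩⟩
  refine lt_of_le_of_lt (b := c' + η + η) (ciSup_le fun ε => ?_) (by simp only [hη]; linarith)
  obtain ⟨r, hr, hrle⟩ := refine_le hΥ' hv hv0 hωpos.le n p' hp'mono hp'0 hp'n hp'm hosc ε.2
  refine (csInf_le (hbdd _ _) hr).trans (hrle.trans ?_)
  linarith
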